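/- Let G be a tree with vertex set V and let Σ be a symmetric positive definite real matrix indexed by V×V that is Markov with respect to G. Let a, c ∈ V be distinct and let Z1, Z2 ⊆ V \ {a, c} be such that σ_{uz|Z1} = 0 for every u ∈ {a, c} and every z ∈ Z2 \ Z1 (i.e., {a,c} ⟂⟂ Z2 | Z1). Then ρ²_{ac|Z1} ≤ ρ²_{ac|Z2}. -/

import Mathlib

open Matrix

variable {V : Type*}

/-- Partial covariance `σ_{uv|Z} = Σ_{uv} − Σ_{uZ} (Σ_{ZZ})⁻¹ Σ_{Zv}`. -/
noncomputable def pcov [Fintype V] [DecidableEq V] (S : Matrix V V ℝ) (u v : V) (Z : Finset V) : ℝ :=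
  S u v - ∑ i : {x // x ∈ Z}, ∑ j : {x // x ∈ Z},
    S u (i : V) * (Matrix.of (fun i j : {x // x ∈ Z} => S (i : V) (j : V)))⁻¹ i j * S (j : V) v

/-- Squared partial correlation `ρ²_{uv|Z}`. -/
noncomputable def rho2 [Fintype V] [DecidableEq V] (S : Matrix V V ℝ) (u v : V) (Z : Finset V) : ℝ :=
  pcov S u v Z ^ 2 / (pcov S u u Z * pcov S v v Z)
/-- `S` separates `A` from `C` in `G`: every path in `G` from a vertex of `A`
to a vertex of `C` contains a vertex of `S`. -/
def Separates {W : Type*} (G : SimpleGraph W) (A C S : Set W) : Prop :=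
  ∀ ⦃a⦄, a ∈ A → ∀ ⦃c⦄, c ∈ C → ∀ p : G.Walk a c, p.IsPath → ∃ s ∈ S, s ∈ p.support

/-- `v` lies on the (unique, for a tree) path joining `x` and `y` in `G`. -/
def OnPath {W : Type*} (G : SimpleGraph W) (x y v : W) : Prop :=
  ∃ p : G.Walk x y, p.IsPath ∧ v ∈ p.support

/-- `Σ` is Markov with respect to `G`: separation implies vanishing partial covariance. -/
def MarkovTree [Fintype V] [DecidableEq V] (G : SimpleGraph V) (S : Matrix V V ℝ) : Prop :=
  ∀ u v : V, u ≠ v → ∀ Z : Finset V, u ∉ Z → v ∉ Z →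
    Separates G {u} {v} (↑Z : Set V) → pcov S u v Z = 0

/-- The residual of the regression of `u` on `Z`: coefficients `r` agreeing with the indicator of
`u` off `Z`, such that the combination `r ᵥ* S` vanishes on `Z`. -/
def IsResidual [DecidableEq V] [Fintype V] (S : Matrix V V ℝ) (u : V) (Z : Finset V)
    (r : V → ℝ) : Prop :=
  (∀ i ∉ Z, r i = Pi.single (M := fun _ => ℝ) u 1 i) ∧ ∀ j ∈ Z, (r ᵥ* S) j = 0

/-- The principal submatrix on `Z` occurring in `pcov` is positive definite. -/
lemma posDef_principal {S : Matrix V V ℝ} (hpd : S.PosDef) (Z : Finset V) :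
    (Matrix.of (fun i j : {x // x ∈ Z} => S (i : V) (j : V))).PosDef :=
  hpd.submatrix (e := fun i : {x // x ∈ Z} => (i : V)) Subtype.val_injective

lemma vecMul_dotProduct_nonneg [Fintype V] {S : Matrix V V ℝ} (hpd : S.PosDef) (x : V → ℝ) :
    0 ≤ (x ᵥ* S) ⬝ᵥ x := by
  rw [← Matrix.dotProduct_mulVec]
  simpa using hpd.posSemidef.dotProduct_mulVec_nonneg x

lemma eq_zero_of_vecMul_dotProduct [Fintype V] {S : Matrix V V ℝ} (hpd : S.PosDef)
    {x : V → ℝ} (hx : (x ᵥ* S) ⬝ᵥ x = 0) :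
    x = 0 := by
  by_contra h
  have := hpd.dotProduct_mulVec_pos h
  rw [← Matrix.dotProduct_mulVec] at hx
  simp [hx] at this

section PartialCovariance

variable [Fintype V] [DecidableEq V] {S : Matrix V V ℝ}

lemma exists_isResidual (hpd : S.PosDef) (u : V) (Z : Finset V) :
    ∃ r, IsResidual S u Z r ∧ ∀ v, pcov S u v Z = (r ᵥ* S) v := by
  set M := Matrix.of (fun i j : {x // x ∈ Z} => S (i : V) (j : V)) with hM
  have hMu : IsUnit M.det := (Matrix.isUnit_iff_isUnit_det _).1 (posDef_principal hpd Z).isUnit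
  set b : {x // x ∈ Z} → ℝ := fun i => S u i with hb
  set w : {x // x ∈ Z} → ℝ := b ᵥ* M⁻¹ with hw
  set e : V → ℝ := fun i => if h : i ∈ Z then w ⟨i, h⟩ else 0 with he
  have hsum (v : V) : (e ᵥ* S) v = ∑ i : {x // x ∈ Z}, w i * S i v := by
    simp only [Matrix.vecMul, dotProduct]
    rw [← Finset.sum_subset (Finset.subset_univ Z), ← Finset.sum_coe_sort]
    · exact Finset.sum_congr rfl fun i _ => by simp [he]
    · intro i _ hi
      simp [he, hi]
  have hr (v : V) : ((Pi.single u 1 - e) ᵥ* S) v = S u v - ∑ i : {x // x ∈ Z}, w i * S i v := by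
    rw [Matrix.sub_vecMul, Pi.sub_apply, hsum, Matrix.single_one_vecMul, Matrix.row]
  refine ⟨Pi.single u 1 - e, ⟨fun i hi => by simp [he, hi], fun j hj => ?_⟩, fun v => ?_⟩
  · have : (w ᵥ* M) ⟨j, hj⟩ = b ⟨j, hj⟩ := by
      rw [hw, Matrix.vecMul_vecMul, Matrix.nonsing_inv_mul _ hMu, Matrix.vecMul_one]
    rw [hr, sub_eq_zero]
    exact this.symm
  · rw [hr, pcov, Finset.sum_comm]
    simp only [hw, hb, Matrix.vecMul, dotProduct, Finset.sum_mul]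
    rfl

lemma IsResidual.eq (hpd : S.PosDef) {u : V} {Z : Finset V} {r r' : V → ℝ}
    (h : IsResidual S u Z r) (h' : IsResidual S u Z r') : r = r' := by
  refine sub_eq_zero.1 (eq_zero_of_vecMul_dotProduct hpd (Finset.sum_eq_zero fun i _ => ?_))
  by_cases hi : i ∈ Z
  · simp [Matrix.sub_vecMul, h.2 i hi, h'.2 i hi]
  · simp [h.1 i hi, h'.1 i hi]

lemma IsResidual.pcov_eq (hpd : S.PosDef) {u : V} {Z : Finset V} {r : V → ℝ}
    (h : IsResidual S u Z r) (v : V) : pcov S u v Z = (r ᵥ* S) v := by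
  obtain ⟨r', hr', hp⟩ := exists_isResidual hpd u Z
  rw [hp, h.eq hpd hr']

lemma IsResidual.vecMul_dotProduct {u v : V} {Z : Finset V} {r r' : V → ℝ}
    (h : IsResidual S u Z r) (h' : IsResidual S v Z r') :
    (r ᵥ* S) ⬝ᵥ r' = (r ᵥ* S) v := by
  rw [← dotProduct_single_one (r ᵥ* S) v]
  refine Finset.sum_congr rfl fun i _ => ?_
  by_cases hi : i ∈ Z
  · simp [h.2 i hi]
  · rw [h'.1 i hi]

lemma pcov_comm (hsym : S.IsSymm) (hpd : S.PosDef) (u v : V) (Z : Finset V) :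
    pcov S u v Z = pcov S v u Z := by
  obtain ⟨r, hr, hp⟩ := exists_isResidual hpd u Z
  obtain ⟨r', hr', hp'⟩ := exists_isResidual hpd v Z
  rw [hp, hp', ← hr.vecMul_dotProduct hr', ← hr'.vecMul_dotProduct hr,
    ← Matrix.dotProduct_mulVec, dotProduct_comm, ← Matrix.vecMul_transpose, hsym.eq]

lemma pcov_self_nonneg (hpd : S.PosDef) (u : V) (Z : Finset V) : 0 ≤ pcov S u u Z := by
  obtain ⟨r, hr, hp⟩ := exists_isResidual hpd u Z
  rw [hp, ← hr.vecMul_dotProduct hr]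
  exact vecMul_dotProduct_nonneg hpd r

lemma pcov_self_pos (hpd : S.PosDef) {u : V} {Z : Finset V} (hu : u ∉ Z) :
    0 < pcov S u u Z := by
  refine (pcov_self_nonneg hpd u Z).lt_of_ne' fun h0 => ?_
  obtain ⟨r, hr, hp⟩ := exists_isResidual hpd u Z
  rw [hp, ← hr.vecMul_dotProduct hr] at h0
  have h1 := hr.1 u hu
  rw [eq_zero_of_vecMul_dotProduct hpd h0] at h1
  simp at h1

/-- Partial covariances are updated by a Schur complement when conditioning on one more vertex. -/
lemma pcov_insert (hpd : S.PosDef) (u v : V) {z : V} {Z : Finset V} (hz : z ∉ Z) :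
    pcov S u v (insert z Z)
      = pcov S u v Z - pcov S u z Z * pcov S z v Z / pcov S z z Z := by
  obtain ⟨r, hr, hp⟩ := exists_isResidual hpd u Z
  obtain ⟨r', hr', hp'⟩ := exists_isResidual hpd z Z
  have hzz := (pcov_self_pos hpd hz).ne'
  have key : IsResidual S u (insert z Z) (r - (pcov S u z Z / pcov S z z Z) • r') := by
    refine ⟨fun i hi => ?_, fun j hj => ?_⟩
    · rw [Finset.mem_insert, not_or] at hi
      simp [hr.1 i hi.2, hr'.1 i hi.2, hi.1]
    · rw [Matrix.sub_vecMul, Matrix.smul_vecMul, Pi.sub_apply, Pi.smul_apply, smul_eq_mul]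
      rcases Finset.mem_insert.1 hj with rfl | hj
      · rw [← hp, ← hp', div_mul_cancel₀ _ hzz, sub_self]
      · rw [hr.2 j hj, hr'.2 j hj, mul_zero, sub_zero]
  rw [key.pcov_eq hpd, Matrix.sub_vecMul, Matrix.smul_vecMul, Pi.sub_apply, Pi.smul_apply,
    smul_eq_mul, ← hp, ← hp']
  ring

lemma pcov_sq_le (hsym : S.IsSymm) (hpd : S.PosDef) (u : V) {b : V} {Z : Finset V}
    (hb : b ∉ Z) : pcov S u b Z ^ 2 ≤ pcov S u u Z * pcov S b b Z := by
  have h := pcov_self_nonneg hpd u (insert b Z)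
  rwa [pcov_insert hpd u u hb, pcov_comm hsym hpd b u, sub_nonneg,
    div_le_iff₀ (pcov_self_pos hpd hb), ← sq] at h

/-- Conditioning further on vertices uncorrelated with `u` given `Z` changes nothing. -/
lemma pcov_union_eq (hpd : S.PosDef) {u : V} {Z T : Finset V}
    (h : ∀ z ∈ T \ Z, pcov S u z Z = 0) (v : V) : pcov S u v (Z ∪ T) = pcov S u v Z := by
  obtain ⟨r, hr, hp⟩ := exists_isResidual hpd u Z
  have key : IsResidual S u (Z ∪ T) r := by
    refine ⟨fun i hi => hr.1 i fun hZ => hi (Finset.mem_union_left _ hZ), fun j hj => ?_⟩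
    by_cases hjZ : j ∈ Z
    · exact hr.2 j hjZ
    · rw [← hp]
      exact h j (Finset.mem_sdiff.2 ⟨(Finset.mem_union.1 hj).resolve_left hjZ, hjZ⟩)
  rw [key.pcov_eq hpd, hp]

lemma MarkovTree.pcov_mul_pcov {G : SimpleGraph V} (hM : MarkovTree G S) (hsym : S.IsSymm)
    (hpd : S.PosDef) {u v b : V} {Z : Finset V} (huv : u ≠ v) (hu : u ∉ Z) (hv : v ∉ Z)
    (hb : b ∉ Z) (hsep : Separates G {u} {v} {b}) :
    pcov S u v Z * pcov S b b Z = pcov S u b Z * pcov S v b Z := by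
  by_cases hub : u = b
  · subst hub
    rw [pcov_comm hsym hpd v u, mul_comm]
  by_cases hvb : v = b
  · rw [hvb]
  have h0 : pcov S u v (insert b Z) = 0 := by
    refine hM u v huv _ (by simp [hub, hu]) (by simp [hvb, hv]) fun x hx y hy p hp => ?_
    obtain ⟨s, rfl, hs⟩ := hsep hx hy p hp
    exact ⟨s, by simp, hs⟩
  have hbb := (pcov_self_pos hpd hb).ne'
  rw [pcov_insert hpd u v hb, pcov_comm hsym hpd b v] at h0
  field_simp at h0
  linarith

end PartialCovariance

section Median

variable {G : SimpleGraph V}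

lemma SimpleGraph.Walk.IsPath.append_of_inter {x y z : V} {p : G.Walk x y} {q : G.Walk y z}
    (hp : p.IsPath) (hq : q.IsPath) (h : ∀ v ∈ p.support, v ∈ q.support → v = y) :
    (p.append q).IsPath := by
  have hq' : (y :: q.support.tail).Nodup := by
    rw [SimpleGraph.Walk.cons_tail_support]
    exact hq.support_nodup
  rw [SimpleGraph.Walk.isPath_def, SimpleGraph.Walk.support_append]
  refine hp.support_nodup.append hq'.of_cons fun v hvp hvq => ?_
  exact (List.nodup_cons.1 hq').1 (h v hvp (List.mem_of_mem_tail hvq) ▸ hvq)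

lemma SimpleGraph.IsTree.separates_of_onPath (hG : G.IsTree) {x y b : V} (h : OnPath G x y b) :
    Separates G {x} {y} {b} := by
  rintro _ rfl _ rfl q hq
  obtain ⟨p, hp, hb⟩ := h
  obtain rfl : p = q := congrArg Subtype.val
    ((hG.isAcyclic.subsingleton_path _ _).elim ⟨p, hp⟩ ⟨q, hq⟩)
  exact ⟨b, rfl, hb⟩

lemma OnPath.symm {x y b : V} (h : OnPath G x y b) : OnPath G y x b := by
  obtain ⟨p, hp, hb⟩ := h
  exact ⟨p.reverse, hp.reverse, by simpa using hb⟩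

/-- Any three vertices of a connected graph have a common vertex on paths joining them pairwise. -/
lemma SimpleGraph.Connected.exists_onPath (hG : G.Connected) (x y z : V) :
    ∃ b, OnPath G x y b ∧ OnPath G x z b ∧ OnPath G y z b := by
  classical
  obtain ⟨p, hp, -⟩ := hG.exists_path_of_dist x y
  obtain ⟨b, hb, hmin⟩ := p.support.toFinset.exists_min_image (G.dist z)
    ⟨x, by simp⟩
  simp only [List.mem_toFinset] at hb hmin
  obtain ⟨q, hq, hlen⟩ := hG.exists_path_of_dist z b
  have hinter : ∀ v ∈ q.support, v ∈ p.support → v = b := by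
    intro v hv hvp
    by_contra hvb
    have h1 := SimpleGraph.Walk.length_takeUntil_lt_length hv hvb
    have h2 := SimpleGraph.dist_le (q.takeUntil v hv)
    have h3 := hmin v hvp
    omega
  refine ⟨b, ⟨p, hp, hb⟩, OnPath.symm ⟨q.append (p.takeUntil b hb).reverse, ?_, by simp⟩,
    OnPath.symm ⟨q.append (p.dropUntil b hb), ?_, by simp⟩⟩
  · refine hq.append_of_inter (hp.takeUntil hb).reverse fun v hv hv' => hinter v hv ?_
    rw [SimpleGraph.Walk.support_reverse, List.mem_reverse] at hv'
    exact p.support_takeUntil_subset_support hb hv'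
  · exact hq.append_of_inter (hp.dropUntil hb) fun v hv hv' =>
      hinter v hv (p.support_dropUntil_subset_support hb hv')

end Median

/-- If three variables with variances `A`, `C`, `D` are conditionally independent given a fourth one
of variance `B`, with covariances `x`, `y`, `w` to it, then conditioning on the third does not
increase the squared correlation of the first two. -/
lemma sq_partial_correlation_le {A B C D x y w m p q : ℝ} (hA : 0 < A) (hB : 0 < B) (hC : 0 < C)
    (hD : 0 < D) (hm : m * B = x * y) (hp : p * B = x * w) (hq : q * B = y * w)
    (hx : x ^ 2 ≤ A * B) (hy : y ^ 2 ≤ C * B) (hw : w ^ 2 ≤ D * B)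
    (hA' : 0 < A - p * p / D) (hC' : 0 < C - q * q / D) :
    (m - p * q / D) ^ 2 / ((A - p * p / D) * (C - q * q / D)) ≤ m ^ 2 / (A * C) := by
  obtain rfl : m = x * y / B := by field_simp; exact hm
  obtain rfl : p = x * w / B := by field_simp; exact hp
  obtain rfl : q = y * w / B := by field_simp; exact hq
  set t := 1 - w ^ 2 / (D * B) with ht
  have hs0 : 0 ≤ w ^ 2 / (D * B) := by positivity
  have ht0 : 0 ≤ t := by
    rw [ht, sub_nonneg]
    exact (div_le_one (by positivity)).2 hw
  have hxA : x ^ 2 / B ≤ A := (div_le_iff₀ hB).2 hx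
  have hyC : y ^ 2 / B ≤ C := (div_le_iff₀ hB).2 hy
  have e1 : x * y / B - x * w / B * (y * w / B) / D = x * y / B * t := by
    rw [ht]; field_simp
  have e2 : A * t ≤ A - x * w / B * (x * w / B) / D := by
    have : x * w / B * (x * w / B) / D = x ^ 2 / B * (w ^ 2 / (D * B)) := by field_simp
    rw [this, ht]
    nlinarith [mul_le_mul_of_nonneg_right hxA hs0]
  have e3 : C * t ≤ C - y * w / B * (y * w / B) / D := by
    have : y * w / B * (y * w / B) / D = y ^ 2 / B * (w ^ 2 / (D * B)) := by field_simp
    rw [this, ht]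
    nlinarith [mul_le_mul_of_nonneg_right hyC hs0]
  rw [e1, div_le_div_iff₀ (mul_pos hA' hC') (mul_pos hA hC)]
  calc (x * y / B * t) ^ 2 * (A * C) = (x * y / B) ^ 2 * (A * t * (C * t)) := by ring
    _ ≤ _ := by gcongr

section Tree

variable [Fintype V] [DecidableEq V] {G : SimpleGraph V} {S : Matrix V V ℝ}

lemma rho2_nonneg (hpd : S.PosDef) (a c : V) (Z : Finset V) : 0 ≤ rho2 S a c Z :=
  div_nonneg (sq_nonneg _) (mul_nonneg (pcov_self_nonneg hpd a Z) (pcov_self_nonneg hpd c Z))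

lemma rho2_insert_le (hG : G.IsTree) (hsym : S.IsSymm) (hpd : S.PosDef) (hM : MarkovTree G S)
    {a c z : V} {Z : Finset V} (hac : a ≠ c) (haz : a ≠ z) (hcz : c ≠ z) (ha : a ∉ Z)
    (hc : c ∉ Z) (hz : z ∉ Z) : rho2 S a c (insert z Z) ≤ rho2 S a c Z := by
  obtain ⟨b, h1, h2, h3⟩ := hG.connected.exists_onPath a c z
  replace h1 := hG.separates_of_onPath h1
  replace h2 := hG.separates_of_onPath h2
  replace h3 := hG.separates_of_onPath h3
  by_cases hb : b ∈ Z
  · have mono {x y : V} (h : Separates G {x} {y} {b}) : Separates G {x} {y} (Z : Set V) := by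
      intro x hx y hy p hp
      obtain ⟨s, rfl, hs⟩ := h hx hy p hp
      exact ⟨s, hb, hs⟩
    have h0 : rho2 S a c (insert z Z) = 0 := by
      simp [rho2, pcov_insert hpd a c hz, hM a c hac Z ha hc (mono h1),
        hM a z haz Z ha hz (mono h2)]
    rw [h0]
    exact rho2_nonneg hpd a c Z
  · have hA' := pcov_self_pos hpd (u := a) (Z := insert z Z) (by simp [haz, ha])
    have hC' := pcov_self_pos hpd (u := c) (Z := insert z Z) (by simp [hcz, hc])
    rw [pcov_insert hpd _ _ hz, pcov_comm hsym hpd z] at hA' hC'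
    simp only [rho2, pcov_insert hpd _ _ hz, pcov_comm hsym hpd z a, pcov_comm hsym hpd z c]
    exact sq_partial_correlation_le (pcov_self_pos hpd ha) (pcov_self_pos hpd hb)
      (pcov_self_pos hpd hc) (pcov_self_pos hpd hz)
      (hM.pcov_mul_pcov hsym hpd hac ha hc hb h1) (hM.pcov_mul_pcov hsym hpd haz ha hz hb h2)
      (hM.pcov_mul_pcov hsym hpd hcz hc hz hb h3) (pcov_sq_le hsym hpd a hb)
      (pcov_sq_le hsym hpd c hb) (pcov_sq_le hsym hpd z hb) hA' hC'

/-- On a Gaussian tree, squared partial correlations decrease with the conditioning set. -/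
lemma rho2_union_le (hG : G.IsTree) (hsym : S.IsSymm) (hpd : S.PosDef) (hM : MarkovTree G S)
    {a c : V} {Z T : Finset V} (hac : a ≠ c) (ha : a ∉ Z) (hc : c ∉ Z) (haT : a ∉ T)
    (hcT : c ∉ T) : rho2 S a c (T ∪ Z) ≤ rho2 S a c Z := by
  induction T using Finset.induction_on with
  | empty => simp
  | insert z T _ ih =>
    simp only [Finset.mem_insert, not_or] at haT hcT
    refine le_trans ?_ (ih haT.2 hcT.2)
    rw [Finset.insert_union]
    by_cases hz : z ∈ T ∪ Z
    · rw [Finset.insert_eq_of_mem hz]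
    · exact rho2_insert_le hG hsym hpd hM hac haT.1 hcT.1 (by simp [ha, haT.2])
        (by simp [hc, hcT.2]) hz

end Tree

/-- Theorem 7: on a Gaussian tree, if `{a,c} ⟂⟂ Z2 | Z1`
then `ρ²_{ac|Z1} ≤ ρ²_{ac|Z2}`. -/
theorem stmt_14 [Fintype V] [DecidableEq V] [Nonempty V]
    (G : SimpleGraph V) (hG : G.IsTree)
    (S : Matrix V V ℝ) (hsym : S.IsSymm) (hpd : S.PosDef) (hM : MarkovTree G S)
    (a c : V) (hac : a ≠ c)
    (Z1 Z2 : Finset V) (haZ1 : a ∉ Z1) (hcZ1 : c ∉ Z1) (haZ2 : a ∉ Z2) (hcZ2 : c ∉ Z2)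
    (h : ∀ u ∈ ({a, c} : Finset V), ∀ z ∈ Z2 \ Z1, pcov S u z Z1 = 0) :
    rho2 S a c Z1 ≤ rho2 S a c Z2 := by
  have eqa := pcov_union_eq hpd (h a (by simp))
  have eqc := pcov_union_eq hpd (h c (by simp))
  calc rho2 S a c Z1 = rho2 S a c (Z1 ∪ Z2) := by simp only [rho2, eqa, eqc]
    _ ≤ rho2 S a c Z2 := rho2_union_le hG hsym hpd hM hac haZ2 hcZ2 haZ1 hcZ1
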